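/- arXiv:1601.00931 — 10 statements merged into one kernel-verified Lean document; each statement's English description precedes it below -/
import Mathlib

section
/- Let p : (0, ∞) → ℝ be continuously differentiable with 0 < p′ < 1, and let F be an antiderivative of ω ↦ √(p′(ω))/(ω + p(ω)). Let A, B : ℝ² → ℝ be given positive functions and κ a constant. Suppose ρ, v : ℝ² → ℝ are differentiable at a point (t, r) with r > 0, ρ(t, r) > 0, |v(t, r)| < 1, and that at (t, r) the pair V = (ρ, v)ᵀ satisfies the primitive-variable system ∂V/∂t + J ∂V/∂r = H. Define the Riemann invariants ψ₋ = ½ ln((1 + v)/(1 − v)) + F(ρ) and ψ₊ = ½ ln((1 + v)/(1 − v)) − F(ρ), and set c_s = √(p′(ρ)). Then at (t, r): ∂ψ₋/∂t + λ₊ ∂ψ₋/∂r = s₋ and ∂ψ₊/∂t + λ₋ ∂ψ₊/∂r = s₊, where s∓ := H₂/(1 − v²) ± c_s H₁/(ρ + p) and λ± = √(AB)(v ± c_s)/(1 ± v c_s). -/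
/-- Partial derivative with respect to the first (time) variable. -/
noncomputable def pdt (f : ℝ × ℝ → ℝ) (x : ℝ × ℝ) : ℝ := fderiv ℝ f x (1, 0)

/-- Partial derivative with respect to the second (radial) variable. -/
noncomputable def pdr (f : ℝ × ℝ → ℝ) (x : ℝ × ℝ) : ℝ := fderiv ℝ f x (0, 1)

open Filter Topology in
/-- If `p' > 0` on `(0, ∞)`, then `ω ↦ √(p' ω) / (ω + p ω)` can only have an antiderivative
when its denominator does not vanish. -/
lemma add_ne_zero_of_hasDerivAt_sqrt_div {p F : ℝ → ℝ}
    (hp : ContDiffOn ℝ 1 p (Set.Ioi 0)) (hp' : ∀ ω ∈ Set.Ioi (0 : ℝ), 0 < deriv p ω)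
    (hF : ∀ ω ∈ Set.Ioi (0 : ℝ), HasDerivAt F (Real.sqrt (deriv p ω) / (ω + p ω)) ω)
    {a : ℝ} (ha : 0 < a) : a + p a ≠ 0 := by
  intro h0
  have hnhds : Set.Ioi (0 : ℝ) ∈ 𝓝 a := Ioi_mem_nhds ha
  have hmono : StrictMonoOn p (Set.Ioi 0) :=
    strictMonoOn_of_deriv_pos (convex_Ioi 0) hp.continuousOn fun ω hω =>
      hp' ω (interior_subset hω)
  have hsqrt : Tendsto (fun ω => Real.sqrt (deriv p ω)) (𝓝[>] a)
      (𝓝 (Real.sqrt (deriv p a))) :=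
    (((hp.continuousOn_deriv_of_isOpen isOpen_Ioi le_rfl).continuousAt hnhds).sqrt).tendsto.mono_left
      nhdsWithin_le_nhds
  have hden : Tendsto (fun ω => ω + p ω) (𝓝[>] a) (𝓝[>] 0) := by
    refine tendsto_nhdsWithin_iff.2 ⟨?_, ?_⟩
    · have hcont : ContinuousAt (fun ω => ω + p ω) a :=
        continuousAt_id.add (hp.continuousOn.continuousAt hnhds)
      simpa only [h0] using hcont.tendsto.mono_left nhdsWithin_le_nhds
    · filter_upwards [self_mem_nhdsWithin] with ω hω
      have hω' : a < ω := hω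
      have := hmono ha (ha.trans hω') hω'
      exact Set.mem_Ioi.2 (by linarith)
  have hlim : Tendsto (deriv F) (𝓝[>] a) atTop := by
    refine (hsqrt.pos_mul_atTop (Real.sqrt_pos.2 (hp' a ha))
      hden.inv_tendsto_nhdsGT_zero).congr' ?_
    filter_upwards [self_mem_nhdsWithin] with ω hω
    rw [(hF ω (ha.trans hω)).deriv, div_eq_mul_inv, Pi.inv_apply]
  exact not_differentiableWithinAt_of_deriv_tendsto_atTop_Ioi F hlim
    (hF a ha).differentiableAt.differentiableWithinAt

lemma hasDerivAt_half_log_div {w : ℝ} (hw : |w| < 1) :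
    HasDerivAt (fun y : ℝ => (1 / 2) * Real.log ((1 + y) / (1 - y))) (1 / (1 - w ^ 2)) w := by
  obtain ⟨h1, h2⟩ := abs_lt.1 hw
  have hadd : 1 + w ≠ 0 := by linarith
  have hsub : 1 - w ≠ 0 := by linarith
  have hsq : 1 - w ^ 2 ≠ 0 := by
    rw [show 1 - w ^ 2 = (1 + w) * (1 - w) by ring]
    exact mul_ne_zero hadd hsub
  have h := (((((hasDerivAt_id w).const_add 1).div ((hasDerivAt_id w).const_sub 1) hsub).log
    (div_ne_zero hadd hsub)).const_mul (1 / 2))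
  refine h.congr_deriv ?_
  simp only [id, Pi.div_apply]
  field_simp
  ring

/-- Left multiplication of the primitive-variable system by the left eigenvector
`(s / q, 1 / (1 - w²))` diagonalizes it; here `s = ± c_s`. -/
lemma characteristic_relation {w s q k ρt ρr vt vr H₁ H₂ : ℝ}
    (hw : 1 - w ^ 2 ≠ 0) (hadd : 1 + w * s ≠ 0) (hsub : 1 - w * s ≠ 0) (hq : q ≠ 0)
    (h₁ : ρt + k / (1 - w ^ 2 * s ^ 2) * (w * (1 - s ^ 2) * ρr + q * vr) = H₁)
    (h₂ : vt + k / (1 - w ^ 2 * s ^ 2) *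
      ((1 - w ^ 2) ^ 2 * s ^ 2 / q * ρr + w * (1 - s ^ 2) * vr) = H₂) :
    (1 / (1 - w ^ 2) * vt + s / q * ρt) +
      k * (w + s) / (1 + w * s) * (1 / (1 - w ^ 2) * vr + s / q * ρr) =
      H₂ / (1 - w ^ 2) + s * H₁ / q := by
  rw [← h₁, ← h₂, show 1 - w ^ 2 * s ^ 2 = (1 + w * s) * (1 - w * s) by ring]
  field_simp
  ring

/-- If `(ρ, v)` satisfies the primitive-variable form of the spherically symmetric
general relativistic hydrodynamic system at a point, then the Riemann invariants
`ψ∓ = ½ ln((1+v)/(1−v)) ± F(ρ)` satisfy the characteristic relations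
`∂ψ₋/∂t + λ₊ ∂ψ₋/∂r = s₋` and `∂ψ₊/∂t + λ₋ ∂ψ₊/∂r = s₊`, where
`s∓ = H₂/(1 − v²) ± c_s H₁/(ρ + p)` and `λ± = √(AB)(v ± c_s)/(1 ± v c_s)`. -/
theorem stmt3 (p F : ℝ → ℝ)
    (hp : ContDiffOn ℝ 1 p (Set.Ioi 0))
    (hp' : ∀ ω ∈ Set.Ioi (0 : ℝ), deriv p ω ∈ Set.Ioo (0 : ℝ) 1)
    (hF : ∀ ω ∈ Set.Ioi (0 : ℝ), HasDerivAt F (Real.sqrt (deriv p ω) / (ω + p ω)) ω)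
    (A B : ℝ × ℝ → ℝ) (hA : ∀ x, 0 < A x) (hB : ∀ x, 0 < B x) (κ : ℝ)
    (ρ v : ℝ × ℝ → ℝ) (t r : ℝ) (hr : 0 < r)
    (hρ : DifferentiableAt ℝ ρ (t, r)) (hv : DifferentiableAt ℝ v (t, r))
    (hρ0 : 0 < ρ (t, r)) (hv0 : |v (t, r)| < 1) :
    let x : ℝ × ℝ := (t, r)
    let ρ₀ : ℝ := ρ x
    let v₀ : ℝ := v x
    let p₀ : ℝ := p ρ₀
    let cs : ℝ := Real.sqrt (deriv p ρ₀)
    let sab : ℝ := Real.sqrt (A x * B x)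
    let H₁ : ℝ := -(sab / (r * (1 - v₀ ^ 2 * cs ^ 2))) *
      (2 * v₀ * (ρ₀ + p₀) * (1 - κ * r ^ 2 * (ρ₀ + p₀) / (4 * A x)))
    let H₂ : ℝ := -(sab / (r * (1 - v₀ ^ 2 * cs ^ 2))) *
      ((1 - v₀ ^ 2) * (-(2 * v₀ ^ 2 * cs ^ 2) +
        (1 - A x) * (1 - v₀ ^ 2 * cs ^ 2) / (2 * A x) +
        κ * r ^ 2 * (p₀ + ρ₀ * v₀ ^ 2 * cs ^ 2) / (2 * A x)))
    let lm : ℝ := sab * (v₀ - cs) / (1 - v₀ * cs)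
    let lp : ℝ := sab * (v₀ + cs) / (1 + v₀ * cs)
    let ψm : ℝ × ℝ → ℝ := fun y => (1 / 2) * Real.log ((1 + v y) / (1 - v y)) + F (ρ y)
    let ψp : ℝ × ℝ → ℝ := fun y => (1 / 2) * Real.log ((1 + v y) / (1 - v y)) - F (ρ y)
    let sm : ℝ := H₂ / (1 - v₀ ^ 2) + cs * H₁ / (ρ₀ + p₀)
    let sp : ℝ := H₂ / (1 - v₀ ^ 2) - cs * H₁ / (ρ₀ + p₀)
    (pdt ρ x + (sab / (1 - v₀ ^ 2 * cs ^ 2)) *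
        (v₀ * (1 - cs ^ 2) * pdr ρ x + (ρ₀ + p₀) * pdr v x) = H₁) →
    (pdt v x + (sab / (1 - v₀ ^ 2 * cs ^ 2)) *
        ((1 - v₀ ^ 2) ^ 2 * cs ^ 2 / (ρ₀ + p₀) * pdr ρ x + v₀ * (1 - cs ^ 2) * pdr v x) = H₂) →
    pdt ψm x + lp * pdr ψm x = sm ∧ pdt ψp x + lm * pdr ψp x = sp := by
  intro x ρ₀ v₀ p₀ cs sab H₁ H₂ lm lp ψm ψp sm sp h₁ h₂
  have hq : ρ₀ + p₀ ≠ 0 :=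
    add_ne_zero_of_hasDerivAt_sqrt_div hp (fun ω hω => (hp' ω hω).1) hF hρ0
  have hv₀ : |v₀| < 1 := hv0
  have hcs : |cs| < 1 := by
    rw [abs_of_nonneg (Real.sqrt_nonneg _), Real.sqrt_lt' one_pos, one_pow]
    exact (hp' ρ₀ hρ0).2
  have hvcs : |v₀ * cs| < 1 := by
    rw [abs_mul]
    exact mul_lt_one_of_nonneg_of_lt_one_left (abs_nonneg _) hv₀ hcs.le
  obtain ⟨hlt, hgt⟩ := abs_lt.1 hvcs
  have hadd : 1 + v₀ * cs ≠ 0 := by linarith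
  have hsub : 1 - v₀ * cs ≠ 0 := by linarith
  have hsq : 1 - v₀ ^ 2 ≠ 0 := (sub_pos.2 ((sq_lt_one_iff_abs_lt_one v₀).2 hv₀)).ne'
  have hlog := (hasDerivAt_half_log_div hv₀).comp_hasFDerivAt x hv.hasFDerivAt
  have hFρ := (hF ρ₀ hρ0).comp_hasFDerivAt x hρ.hasFDerivAt
  have hψm : fderiv ℝ ψm x = _ := (hlog.add hFρ).fderiv
  have hψp : fderiv ℝ ψp x = _ := (hlog.sub hFρ).fderiv
  constructor
  · have h := characteristic_relation hsq hadd hsub hq h₁ h₂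
    simpa only [pdt, pdr, hψm, add_apply, smul_apply, smul_eq_mul] using h
  · have h := characteristic_relation (s := -cs) (w := v₀) (q := ρ₀ + p₀) (k := sab) hsq
      (by simpa only [mul_neg, ← sub_eq_add_neg] using hsub)
      (by simpa only [mul_neg, sub_neg_eq_add] using hadd) hq
      (by simpa only [neg_sq] using h₁) (by simpa only [neg_sq] using h₂)
    simpa only [pdt, pdr, hψp, sub_apply, smul_apply, smul_eq_mul, mul_neg, neg_mul, neg_div,
      ← sub_eq_add_neg] using h
end

section
/- Let σ ∈ (0, 1) and a > 0 (representing a = √(A_*B_*)). For ω ∈ (−a, a) define v(ω) = (σ + ω/a)/(1 + σ ω/a) and the characteristic speeds λ₋(ω) = a(v(ω) − σ)/(1 − σ v(ω)), λ₊(ω) = a(v(ω) + σ)/(1 + σ v(ω)). Then for all β̂, β ∈ (−a, a): ∫_{β̂}^{β} dω/(λ₊(ω) − λ₋(ω)) = (1/(4σ))·[ (σ − 1)² ln(1 + ϖ) − (σ + 1)² ln(1 − ϖ) ] evaluated from ϖ = β̂/a to ϖ = β/a, i.e. it equals (1/(4σ))·((σ − 1)²(ln(1 + β/a) − ln(1 +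 β̂/a)) − (σ + 1)²(ln(1 − β/a) − ln(1 − β̂/a))). -/
open Set in
/-- Partial fraction form of the reciprocal of the difference of the characteristic speeds. -/
theorem one_div_charSpeed_sub {σ a ω : ℝ} (hσ : σ ∈ Ioo (0 : ℝ) 1) (ha : 0 < a)
    (hω : ω ∈ Ioo (-a) a) :
    1 / (a * ((σ + ω / a) / (1 + σ * ω / a) + σ) / (1 + σ * ((σ + ω / a) / (1 + σ * ω / a))) -
        a * ((σ + ω / a) / (1 + σ * ω / a) - σ) / (1 - σ * ((σ + ω / a) / (1 + σ * ω / a)))) =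
      1 / (4 * σ) * ((σ - 1) ^ 2 * (1 / (a + ω)) + (σ + 1) ^ 2 * (1 / (a - ω))) := by
  obtain ⟨h0, h1⟩ := hσ
  obtain ⟨hl, hr⟩ := hω
  have hp : 0 < a + ω := by linarith
  have hm : 0 < a - ω := by linarith
  have hd : 0 < a + σ * ω := by nlinarith
  have hs : 0 < 1 - σ ^ 2 := by nlinarith
  have he : 0 < a * (1 + σ ^ 2) + 2 * σ * ω := by nlinarith [sq_nonneg (σ - 1)]
  have hv : (σ + ω / a) / (1 + σ * ω / a) = (a * σ + ω) / (a + σ * ω) := by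
    rw [show σ + ω / a = (a * σ + ω) / a by field_simp,
      show 1 + σ * ω / a = (a + σ * ω) / a by field_simp, div_div_div_cancel_right₀ ha.ne']
  have hminus : a * ((a * σ + ω) / (a + σ * ω) - σ) / (1 - σ * ((a * σ + ω) / (a + σ * ω))) =
      ω := by
    have hne : 1 - σ * ((a * σ + ω) / (a + σ * ω)) = a * (1 - σ ^ 2) / (a + σ * ω) := by
      field_simp
      ring
    rw [hne, div_eq_iff (by positivity)]
    field_simp
    ring
  have hplus : a * ((a * σ + ω) / (a + σ * ω) + σ) / (1 + σ * ((a * σ + ω) / (a + σ * ω))) =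
      a * (2 * a * σ + (1 + σ ^ 2) * ω) / (a * (1 + σ ^ 2) + 2 * σ * ω) := by
    have hne : 1 + σ * ((a * σ + ω) / (a + σ * ω)) =
        (a * (1 + σ ^ 2) + 2 * σ * ω) / (a + σ * ω) := by
      field_simp
      ring
    rw [hne, div_eq_div_iff (by positivity) he.ne']
    field_simp
    ring
  have hdiff : a * (2 * a * σ + (1 + σ ^ 2) * ω) / (a * (1 + σ ^ 2) + 2 * σ * ω) - ω =
      2 * σ * ((a + ω) * (a - ω)) / (a * (1 + σ ^ 2) + 2 * σ * ω) := by
    rw [eq_div_iff he.ne', sub_mul, div_mul_cancel₀ _ he.ne']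
    ring
  rw [hv, hminus, hplus, hdiff, one_div_div]
  field_simp
  ring

open Set in
/-- The primitive of the partial fraction form of the reciprocal speed difference. -/
theorem hasDerivAt_log_one_add_log_one_sub (σ : ℝ) {a ω : ℝ} (ha : 0 < a)
    (hω : ω ∈ Ioo (-a) a) :
    HasDerivAt (fun x => 1 / (4 * σ) *
        ((σ - 1) ^ 2 * Real.log (1 + x / a) - (σ + 1) ^ 2 * Real.log (1 - x / a)))
      (1 / (4 * σ) * ((σ - 1) ^ 2 * (1 / (a + ω)) + (σ + 1) ^ 2 * (1 / (a - ω)))) ω := by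
  have hp : 0 < a + ω := by linarith [hω.1]
  have hm : 0 < a - ω := by linarith [hω.2]
  have hp1 : 1 + ω / a = (a + ω) / a := by field_simp
  have hm1 : 1 - ω / a = (a - ω) / a := by field_simp
  have hdiv := (hasDerivAt_id' ω).div_const a
  have hlp := (hdiv.const_add 1).log (by rw [hp1]; positivity)
  have hlm := (hdiv.const_sub 1).log (by rw [hm1]; positivity)
  refine (((hlp.const_mul ((σ - 1) ^ 2)).sub (hlm.const_mul ((σ + 1) ^ 2))).const_mul
    (1 / (4 * σ))).congr_deriv ?_
  rw [hp1, hm1, neg_div, mul_neg, sub_neg_eq_add, div_div_div_cancel_right₀ ha.ne',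
    div_div_div_cancel_right₀ ha.ne']

/-- Closed form of the integral `∫ dω/(λ₊(ω) − λ₋(ω))` appearing in the resolution of a
left rarefaction wave for the equation of state `p(ρ) = σ²ρ`, where inside the fan
`v(ω) = (σ + ω/a)/(1 + σω/a)` with `a = √(A_*B_*)` and
`λ∓(ω) = a(v(ω) ∓ σ)/(1 ∓ σ v(ω))`. -/
theorem stmt6 (σ a : ℝ) (hσ : σ ∈ Set.Ioo (0 : ℝ) 1) (ha : 0 < a) :
    let v : ℝ → ℝ := fun ω => (σ + ω / a) / (1 + σ * ω / a)
    let lm : ℝ → ℝ := fun ω => a * (v ω - σ) / (1 - σ * v ω)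
    let lp : ℝ → ℝ := fun ω => a * (v ω + σ) / (1 + σ * v ω)
    ∀ βh ∈ Set.Ioo (-a) a, ∀ β ∈ Set.Ioo (-a) a,
      (∫ ω in βh..β, 1 / (lp ω - lm ω)) =
        (1 / (4 * σ)) *
          ((σ - 1) ^ 2 * (Real.log (1 + β / a) - Real.log (1 + βh / a)) -
            (σ + 1) ^ 2 * (Real.log (1 - β / a) - Real.log (1 - βh / a))) := by
  intro v lm lp βh hβh β hβ
  have hsub : Set.uIcc βh β ⊆ Set.Ioo (-a) a := Set.ordConnected_Ioo.uIcc_subset hβh hβ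
  rw [intervalIntegral.integral_congr fun ω hω => one_div_charSpeed_sub hσ ha (hsub hω),
    intervalIntegral.integral_eq_sub_of_hasDerivAt
      fun ω hω => hasDerivAt_log_one_add_log_one_sub σ ha (hsub hω)]
  · ring
  · refine ContinuousOn.intervalIntegrable fun ω hω => ContinuousAt.continuousWithinAt ?_
    have hp : a + ω ≠ 0 := (by linarith [(hsub hω).1] : 0 < a + ω).ne'
    have hm : a - ω ≠ 0 := (by linarith [(hsub hω).2] : 0 < a - ω).ne'
    fun_prop (disch := assumption)
end

section
/- Let ρ, p, v and ρ̄, p̄, v̄ be real numbers with |v| < 1, |v̄| < 1, ρ + p̄ > 0 and ρ̄ + p > 0. Define W² = 1/(1 − v²), W̄² = 1/(1 − v̄²), and the stress-energy components 𝒯⁰⁰ = (ρ + p)W² − p, 𝒯⁰¹ = (ρ + p)W²v, 𝒯¹¹ = (ρv² + p)W², and similarly 𝒯̄⁰⁰, 𝒯̄⁰¹, 𝒯̄¹¹ from (ρ̄, p̄, v̄). If there exists a real number s̃ such that the Rankine–Hugoniot conditions 𝒯⁰¹ − 𝒯̄⁰¹ = s̃(𝒯⁰⁰ − 𝒯̄⁰⁰)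 and 𝒯¹¹ − 𝒯̄¹¹ = s̃(𝒯⁰¹ − 𝒯̄⁰¹) hold, then ((v − v̄)/(1 − v v̄))² = (p − p̄)(ρ − ρ̄)/((ρ + p̄)(ρ̄ + p)). -/
/-- The determinant of the jump of the stress-energy tensor of two fluid states with velocities
`v`, `w`, in terms of their densities, pressures and velocities. -/
theorem stress_energy_jump_det {ρ p v r q w : ℝ} (hv : 1 - v ^ 2 ≠ 0) (hw : 1 - w ^ 2 ≠ 0) :
    (((ρ + p) * (1 / (1 - v ^ 2)) * v - (r + q) * (1 / (1 - w ^ 2)) * w) ^ 2 -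
        (((ρ + p) * (1 / (1 - v ^ 2)) - p) - ((r + q) * (1 / (1 - w ^ 2)) - q)) *
        ((ρ * v ^ 2 + p) * (1 / (1 - v ^ 2)) - (r * w ^ 2 + q) * (1 / (1 - w ^ 2)))) *
      ((1 - v ^ 2) * (1 - w ^ 2)) =
    (v - w) ^ 2 * ((ρ + q) * (r + p)) - (p - q) * (ρ - r) * (1 - v * w) ^ 2 := by
  field_simp
  ring

/-- The Rankine–Hugoniot jump conditions for the spherically symmetric general
relativistic hydrodynamic system imply the shock relation
`((v − v̄)/(1 − v v̄))² = (p − p̄)(ρ − ρ̄)/((ρ + p̄)(ρ̄ + p))`. -/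
theorem stmt7 (ρ p v rb pb vb : ℝ) (hv : |v| < 1) (hvb : |vb| < 1)
    (h1 : 0 < ρ + pb) (h2 : 0 < rb + p) :
    let W2 : ℝ := 1 / (1 - v ^ 2)
    let Wb2 : ℝ := 1 / (1 - vb ^ 2)
    let T00 : ℝ := (ρ + p) * W2 - p
    let T01 : ℝ := (ρ + p) * W2 * v
    let T11 : ℝ := (ρ * v ^ 2 + p) * W2
    let Tb00 : ℝ := (rb + pb) * Wb2 - pb
    let Tb01 : ℝ := (rb + pb) * Wb2 * vb
    let Tb11 : ℝ := (rb * vb ^ 2 + pb) * Wb2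
    (∃ st : ℝ, T01 - Tb01 = st * (T00 - Tb00) ∧ T11 - Tb11 = st * (T01 - Tb01)) →
    ((v - vb) / (1 - v * vb)) ^ 2 = (p - pb) * (ρ - rb) / ((ρ + pb) * (rb + p)) := by
  rintro W2 Wb2 T00 T01 T11 Tb00 Tb01 Tb11 ⟨st, e1, e2⟩
  have hv2 : v ^ 2 < 1 := (sq_lt_one_iff_abs_lt_one v).2 hv
  have hvb2 : vb ^ 2 < 1 := (sq_lt_one_iff_abs_lt_one vb).2 hvb
  have hden : 1 - v * vb ≠ 0 := by nlinarith [sq_nonneg (v - vb)]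
  have hdet : (T01 - Tb01) ^ 2 - (T00 - Tb00) * (T11 - Tb11) = 0 := by
    linear_combination (T01 - Tb01) * e1 - (T00 - Tb00) * e2
  have key := stress_energy_jump_det (ρ := ρ) (p := p) (r := rb) (q := pb)
    (sub_pos.2 hv2).ne' (sub_pos.2 hvb2).ne'
  simp only [T00, T01, T11, Tb00, Tb01, Tb11, W2, Wb2] at hdet
  rw [hdet, zero_mul] at key
  rw [div_pow, div_eq_div_iff (pow_ne_zero 2 hden) (mul_pos h1 h2).ne']
  linarith
end

section
/- Let p be a function differentiable at ρ, let ρ̄ be fixed with p̄ = p(ρ̄), and suppose ρ > ρ̄, p(ρ) > p̄, ρ + p̄ > 0 and ρ̄ + p(ρ) > 0. Define Φ(ρ) = √((p(ρ) − p̄)(ρ − ρ̄)/((ρ + p̄)(ρ̄ + p(ρ)))), Δ = √((p(ρ) − p̄)/(ρ − ρ̄)) and c_s² = p′(ρ). Then Φ is differentiable at ρ with Φ′(ρ) = (ρ̄ + p̄)·(c_s²Δ⁻¹(ρ + p̄) + Δ(ρ̄ + p(ρ))) / (2((ρ + p̄)(ρ̄ + p(ρ)))^{3/2}). In particular, if additionally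 ρ̄ + p̄ > 0 and p′(ρ) ≥ 0, then Φ′(ρ) > 0. -/
theorem Real.rpow_three_halves {x : ℝ} (hx : 0 ≤ x) : x ^ ((3 : ℝ) / 2) = √x ^ 3 := by
  rw [Real.sqrt_eq_rpow, ← Real.rpow_natCast, ← Real.rpow_mul hx]
  norm_num


/-- Differentiability and derivative of the shock relative-velocity function
`Φ(ρ) = √((p(ρ) − p̄)(ρ − ρ̄)/((ρ + p̄)(ρ̄ + p(ρ))))` with respect to `ρ`:
`Φ′(ρ) = (ρ̄ + p̄)(c_s²Δ⁻¹(ρ + p̄) + Δ(ρ̄ + p(ρ)))/(2((ρ + p̄)(ρ̄ + p(ρ)))^{3/2})`,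
which is positive when moreover `ρ̄ + p̄ > 0` and `p′(ρ) ≥ 0`. -/
theorem stmt9 (p : ℝ → ℝ) (ρ rb : ℝ) (hdiff : DifferentiableAt ℝ p ρ)
    (h1 : rb < ρ) (h2 : p rb < p ρ) (h3 : 0 < ρ + p rb) (h4 : 0 < rb + p ρ) :
    let pb : ℝ := p rb
    let Φ : ℝ → ℝ := fun x => Real.sqrt ((p x - pb) * (x - rb) / ((x + pb) * (rb + p x)))
    let Δ : ℝ := Real.sqrt ((p ρ - pb) / (ρ - rb))
    let cs2 : ℝ := deriv p ρ
    let D : ℝ := (rb + pb) * (cs2 * Δ⁻¹ * (ρ + pb) + Δ * (rb + p ρ)) /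
      (2 * ((ρ + pb) * (rb + p ρ)) ^ ((3 : ℝ) / 2))
    HasDerivAt Φ D ρ ∧ (0 < rb + pb → 0 ≤ deriv p ρ → 0 < D) := by
  intro pb Φ Δ cs2 D
  have hA : 0 < p ρ - pb := sub_pos.2 h2
  have hR : 0 < ρ - rb := sub_pos.2 h1
  have ha : 0 < ρ + pb := h3
  have hab : 0 < (ρ + pb) * (rb + p ρ) := mul_pos ha h4
  have hΔ : 0 < Δ := Real.sqrt_pos.2 (div_pos hA hR)
  refine ⟨?_, fun hs hc => ?_⟩
  · have hp : HasDerivAt p cs2 ρ := hdiff.hasDerivAt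
    have hF := (((hp.sub_const pb).mul ((hasDerivAt_id ρ).sub_const rb)).div
      (((hasDerivAt_id ρ).add_const pb).mul (hp.const_add rb)) hab.ne').sqrt
      (div_pos (mul_pos hA hR) hab).ne'
    refine hF.congr_deriv ?_
    simp only [D, Δ, Pi.mul_apply, Pi.div_apply, id_eq]
    rw [Real.rpow_three_halves hab.le, Real.sqrt_div (mul_pos hA hR).le,
      Real.sqrt_mul hA.le, Real.sqrt_div hA.le]
    have hu := Real.sqrt_pos.2 hA
    have hw := Real.sqrt_pos.2 hR
    have hg := Real.sqrt_pos.2 hab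
    have hu2 := Real.sq_sqrt hA.le
    have hw2 := Real.sq_sqrt hR.le
    have hg2 := Real.sq_sqrt hab.le
    generalize √(p ρ - pb) = u at *
    generalize √(ρ - rb) = w at *
    generalize √((ρ + pb) * (rb + p ρ)) = g at *
    have hnum : (cs2 * (ρ - rb) + (p ρ - pb) * 1) * ((ρ + pb) * (rb + p ρ)) -
        (p ρ - pb) * (ρ - rb) * (1 * (rb + p ρ) + (ρ + pb) * cs2) =
        (rb + pb) * (cs2 * w ^ 2 * (ρ + pb) + u ^ 2 * (rb + p ρ)) := by
      rw [hu2, hw2]; ring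
    rw [hnum, ← hg2]
    field_simp
  · have hb : 0 < Δ * (rb + p ρ) := mul_pos hΔ h4
    have hc' : 0 ≤ cs2 * Δ⁻¹ * (ρ + pb) :=
      mul_nonneg (mul_nonneg hc (inv_nonneg.2 hΔ.le)) ha.le
    exact div_pos (mul_pos hs (add_pos_of_nonneg_of_pos hc' hb))
      (mul_pos two_pos (Real.rpow_pos_of_pos hab _))
end

section
/- Let ρ_*, p_*, v_*, c, A, B, s, v_R, Φρ be real numbers with A > 0, B > 0, ρ_* + p_* > 0, 0 < c < 1, |v_*| < 1, |v_R| < 1, s > 0, Φρ > 0, and suppose √(AB)(v_* + c)/(1 + v_*c) > s and √(AB)(v_* − c)/(1 − v_*c) < 0. Define a_L = c/(ρ_* + p_*), b_L = 1/(1 − v_*²), a_R = Φρ·(v_*² − c² − s v_*(1 − c²)/√(AB)) + ((v_R² − 1)/(1 − v_* v_R)²)·(s(1 − v_*²)²c²/(√(AB)(ρ_* + p_*))), and b_R = Φρ·(s(ρ_* + p_*)/√(AB)) + ((v_R² − 1)/(1 − v_* v_R)²)·(v_*² − c² − s v_*(1 − c²)/√(AB)). Then a_L b_R − a_R b_L >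 0; in particular the 2×2 linear system a_L x + b_L y = d_L, a_R x + b_R y = d_R has a unique solution for any right-hand side (d_L, d_R). -/
/-- Cramer's rule for a `2 × 2` linear system with nonzero determinant. -/
theorem existsUnique_solution_of_det_ne_zero {K : Type*} [Field K] {a b a' b' : K}
    (h : a * b' - a' * b ≠ 0) (d d' : K) :
    ∃! xy : K × K, a * xy.1 + b * xy.2 = d ∧ a' * xy.1 + b' * xy.2 = d' := by
  refine ⟨((d * b' - d' * b) / (a * b' - a' * b), (a * d' - a' * d) / (a * b' - a' * b)),
    ⟨?_, ?_⟩, ?_⟩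
  · dsimp only
    rw [mul_div_assoc', mul_div_assoc', ← add_div, div_eq_iff h]
    ring
  · dsimp only
    rw [mul_div_assoc', mul_div_assoc', ← add_div, div_eq_iff h]
    ring
  · rintro ⟨x, y⟩ ⟨h₁, h₂⟩
    dsimp only at h₁ h₂
    refine Prod.ext ?_ ?_
    · dsimp only
      rw [eq_div_iff h, ← h₁, ← h₂]
      ring
    · dsimp only
      rw [eq_div_iff h, ← h₁, ← h₂]
      ring


/-- Unique solvability of the 2×2 linear system of the GRP solver: with coefficients
`a_L, b_L` coming from the left rarefaction resolution and `a_R, b_R` from the right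
shock resolution, one has `a_L b_R − a_R b_L > 0`, so the system
`a_L x + b_L y = d_L`, `a_R x + b_R y = d_R` has a unique solution. -/
theorem stmt11 (ρs ps vs c A B s vR Φρ : ℝ) (hA : 0 < A) (hB : 0 < B)
    (hρp : 0 < ρs + ps) (hc0 : 0 < c) (hc1 : c < 1) (hvs : |vs| < 1) (hvR : |vR| < 1)
    (hs : 0 < s) (hΦ : 0 < Φρ)
    (hlax : Real.sqrt (A * B) * (vs + c) / (1 + vs * c) > s)
    (hlm : Real.sqrt (A * B) * (vs - c) / (1 - vs * c) < 0) :
    let sab : ℝ := Real.sqrt (A * B)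
    let aL : ℝ := c / (ρs + ps)
    let bL : ℝ := 1 / (1 - vs ^ 2)
    let aR : ℝ := Φρ * (vs ^ 2 - c ^ 2 - s * vs * (1 - c ^ 2) / sab) +
      ((vR ^ 2 - 1) / (1 - vs * vR) ^ 2) * (s * (1 - vs ^ 2) ^ 2 * c ^ 2 / (sab * (ρs + ps)))
    let bR : ℝ := Φρ * (s * (ρs + ps) / sab) +
      ((vR ^ 2 - 1) / (1 - vs * vR) ^ 2) * (vs ^ 2 - c ^ 2 - s * vs * (1 - c ^ 2) / sab)
    aL * bR - aR * bL > 0 ∧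
      ∀ dL dR : ℝ, ∃! xy : ℝ × ℝ, aL * xy.1 + bL * xy.2 = dL ∧ aR * xy.1 + bR * xy.2 = dR := by
  intro sab aL bL aR bR
  have hsab : 0 < sab := Real.sqrt_pos.mpr (mul_pos hA hB)
  obtain ⟨hv₁, hv₂⟩ := abs_lt.mp hvs
  obtain ⟨hR₁, hR₂⟩ := abs_lt.mp hvR
  have hplus : 0 < 1 + vs * c := by nlinarith
  have hminus : 0 < 1 - vs * c := by nlinarith
  have hvv : 0 < 1 - vs ^ 2 := by nlinarith
  have hRR : 0 < 1 - vR ^ 2 := by nlinarith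
  have hvR' : 0 < 1 - vs * vR := by nlinarith
  have hsum : 0 < c + vs := by
    have h := (div_pos_iff_of_pos_right hplus).mp (hs.trans hlax)
    linarith [(mul_pos_iff_of_pos_left hsab).mp h]
  have hdiff : 0 < c - vs := by
    by_contra! hle
    exact hlm.not_ge (div_nonneg (mul_nonneg hsab.le (by linarith)) hminus.le)
  have hdet : aL * bR - aR * bL =
      (c + vs) * (s / sab * (1 - vs * c) + (c - vs)) *
        (Φρ / (1 - vs ^ 2) + (1 - vR ^ 2) / (1 - vs * vR) ^ 2 * c / (ρs + ps)) := by
    simp only [aL, bL, aR, bR]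
    field_simp
    ring
  have hpos : aL * bR - aR * bL > 0 := by
    rw [hdet]
    positivity
  exact ⟨hpos, existsUnique_solution_of_det_ne_zero hpos.ne'⟩
end

section
/- Let p : (0, ∞) → ℝ be continuously differentiable with 0 < p′ < 1, F an antiderivative of ω ↦ √(p′(ω))/(ω + p(ω)), A, B positive functions, and κ a constant. Suppose ρ, v : ℝ² → ℝ are differentiable at a point (t, r) with r > 0, ρ(t, r) > 0, 0 < v(t, r) < 1, the pair V = (ρ, v)ᵀ satisfies ∂V/∂t + J ∂V/∂r = H at (t, r), and the sonic condition v(t, r) = c_s holds, where c_s = √(p′(ρ)) (so that λ₋ = √(AB)(v − c_s)/(1 − v c_s) = 0). Define ψ₋ = ½ ln((1 + v)/(1 − v)) + F(ρ) and s₊ = H₂/(1 − v²) − c_s H₁/(ρ + p). Then at (t, r): ∂ρ/∂t = ((ρ + p)/(2c_s))·(∂ψ₋/∂t − s₊) and ∂v/∂t = ((1 − v²)/2)·(∂ψ₋/∂t + s₊). -/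
open Set Filter Topology in
/-- If `√(p′(ω)) / (ω + p(ω))` has an antiderivative on `(0, ∞)`, then `ω + p(ω)` vanishes nowhere:
at a zero the quotient takes the value `0` but blows up from the right, contradicting the
intermediate value property of derivatives. -/
theorem add_ne_zero_of_hasDerivAt_sqrt_deriv_div {p F : ℝ → ℝ}
    (hp : ContDiffOn ℝ 1 p (Ioi 0)) (hp' : ∀ ω ∈ Ioi (0 : ℝ), 0 < deriv p ω)
    (hF : ∀ ω ∈ Ioi (0 : ℝ), HasDerivAt F (Real.sqrt (deriv p ω) / (ω + p ω)) ω)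
    {a : ℝ} (ha : 0 < a) : a + p a ≠ 0 := by
  intro h0
  have hmono : StrictMonoOn p (Ioi 0) :=
    strictMonoOn_of_deriv_pos (convex_Ioi 0) hp.continuousOn (by simpa using hp')
  have hcont : ContinuousAt p a := hp.continuousOn.continuousAt (Ioi_mem_nhds ha)
  have hdcont : ContinuousAt (deriv p) a :=
    (hp.continuousOn_deriv_of_isOpen isOpen_Ioi le_rfl).continuousAt (Ioi_mem_nhds ha)
  have hsum : Tendsto (fun ω => ω + p ω) (𝓝[>] a) (𝓝[>] 0) := by
    refine tendsto_nhdsWithin_iff.2 ⟨?_, ?_⟩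
    · have := (continuousAt_id.add hcont).tendsto.mono_left (nhdsWithin_le_nhds (s := Ioi a))
      simpa [h0, id, Pi.add_def] using this
    · filter_upwards [self_mem_nhdsWithin] with ω hω
      have hω' : a < ω := hω
      have := hmono ha (ha.trans hω') hω'
      show 0 < ω + p ω
      linarith
  have hlim : Tendsto (fun ω => Real.sqrt (deriv p ω) / (ω + p ω)) (𝓝[>] a) atTop := by
    simp only [div_eq_mul_inv]
    exact (hdcont.sqrt.tendsto.mono_left nhdsWithin_le_nhds).pos_mul_atTop
      (Real.sqrt_pos.2 (hp' a ha)) (tendsto_inv_nhdsGT_zero.comp hsum)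
  have hev := hlim.eventually_gt_atTop 1
  obtain ⟨b, hab, hb⟩ := mem_nhdsGT_iff_exists_Ioc_subset.1 hev
  have hab' : a < b := hab
  obtain ⟨ξ, hξ, hξ1⟩ := exists_hasDerivWithinAt_eq_of_gt_of_lt (m := 1) hab'.le
    (fun ω hω => (hF ω (ha.trans_le hω.1)).hasDerivWithinAt)
    (by simp [h0]) (hb ⟨hab', le_rfl⟩)
  exact (hb ⟨hξ.1, hξ.2.le⟩ : (1 : ℝ) < _).ne' hξ1

/-- Partial time derivative of the Riemann invariant `½ ln((1 + v)/(1 - v)) + F(ρ)`. -/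
theorem pdt_half_log_add_comp {F : ℝ → ℝ} {ρ v : ℝ × ℝ → ℝ} {x : ℝ × ℝ} {F' : ℝ}
    (hF : HasDerivAt F F' (ρ x)) (hρ : DifferentiableAt ℝ ρ x) (hv : DifferentiableAt ℝ v x)
    (hv0 : -1 < v x) (hv1 : v x < 1) :
    pdt (fun y => (1 / 2) * Real.log ((1 + v y) / (1 - v y)) + F (ρ y)) x =
      pdt v x / (1 - v x ^ 2) + F' * pdt ρ x := by
  have hm : 1 - v x ≠ 0 := by linarith
  have hq : 1 + v x ≠ 0 := by linarith
  have hL : HasDerivAt (fun w : ℝ => (1 / 2) * Real.log ((1 + w) / (1 - w)))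
      (1 / (1 - v x ^ 2)) (v x) := by
    have h := ((((hasDerivAt_id (v x)).const_add 1).div
      ((hasDerivAt_id (v x)).const_sub 1) hm).log (div_ne_zero hq hm)).const_mul (1 / 2)
    refine h.congr_deriv ?_
    have : 1 - v x ^ 2 ≠ 0 := by
      rw [show 1 - v x ^ 2 = (1 - v x) * (1 + v x) by ring]
      exact mul_ne_zero hm hq
    simp only [id, Pi.div_apply]
    field_simp
    ring
  have h := (hL.comp_hasFDerivAt x hv.hasFDerivAt).add (hF.comp_hasFDerivAt x hρ.hasFDerivAt)
  have h' : fderiv ℝ (fun y => (1 / 2) * Real.log ((1 + v y) / (1 - v y)) + F (ρ y)) x = _ :=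
    h.fderiv
  simp only [pdt, h', add_apply, smul_apply, smul_eq_mul]
  ring

/-- The sonic case of the generalized Riemann problem: if `(ρ, v)` satisfies the
primitive-variable system at a point where the sonic condition `v = c_s` holds
(so `λ₋ = 0`), then `∂ρ/∂t = ((ρ+p)/(2c_s))(∂ψ₋/∂t − s₊)` and
`∂v/∂t = ((1−v²)/2)(∂ψ₋/∂t + s₊)`. -/
theorem stmt12 (p F : ℝ → ℝ)
    (hp : ContDiffOn ℝ 1 p (Set.Ioi 0))
    (hp' : ∀ ω ∈ Set.Ioi (0 : ℝ), deriv p ω ∈ Set.Ioo (0 : ℝ) 1)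
    (hF : ∀ ω ∈ Set.Ioi (0 : ℝ), HasDerivAt F (Real.sqrt (deriv p ω) / (ω + p ω)) ω)
    (A B : ℝ × ℝ → ℝ) (hA : ∀ x, 0 < A x) (hB : ∀ x, 0 < B x) (κ : ℝ)
    (ρ v : ℝ × ℝ → ℝ) (t r : ℝ) (hr : 0 < r)
    (hρ : DifferentiableAt ℝ ρ (t, r)) (hv : DifferentiableAt ℝ v (t, r))
    (hρ0 : 0 < ρ (t, r)) (hv0 : 0 < v (t, r)) (hv1 : v (t, r) < 1)
    (hsonic : v (t, r) = Real.sqrt (deriv p (ρ (t, r)))) :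
    let x : ℝ × ℝ := (t, r)
    let ρ₀ : ℝ := ρ x
    let v₀ : ℝ := v x
    let p₀ : ℝ := p ρ₀
    let cs : ℝ := Real.sqrt (deriv p ρ₀)
    let sab : ℝ := Real.sqrt (A x * B x)
    let H₁ : ℝ := -(sab / (r * (1 - v₀ ^ 2 * cs ^ 2))) *
      (2 * v₀ * (ρ₀ + p₀) * (1 - κ * r ^ 2 * (ρ₀ + p₀) / (4 * A x)))
    let H₂ : ℝ := -(sab / (r * (1 - v₀ ^ 2 * cs ^ 2))) *
      ((1 - v₀ ^ 2) * (-(2 * v₀ ^ 2 * cs ^ 2) +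
        (1 - A x) * (1 - v₀ ^ 2 * cs ^ 2) / (2 * A x) +
        κ * r ^ 2 * (p₀ + ρ₀ * v₀ ^ 2 * cs ^ 2) / (2 * A x)))
    let lm : ℝ := sab * (v₀ - cs) / (1 - v₀ * cs)
    let lp : ℝ := sab * (v₀ + cs) / (1 + v₀ * cs)
    let ψm : ℝ × ℝ → ℝ := fun y => (1 / 2) * Real.log ((1 + v y) / (1 - v y)) + F (ρ y)
    let ψp : ℝ × ℝ → ℝ := fun y => (1 / 2) * Real.log ((1 + v y) / (1 - v y)) - F (ρ y)
    let sm : ℝ := H₂ / (1 - v₀ ^ 2) + cs * H₁ / (ρ₀ + p₀)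
    let sp : ℝ := H₂ / (1 - v₀ ^ 2) - cs * H₁ / (ρ₀ + p₀)
    (pdt ρ x + (sab / (1 - v₀ ^ 2 * cs ^ 2)) *
        (v₀ * (1 - cs ^ 2) * pdr ρ x + (ρ₀ + p₀) * pdr v x) = H₁) →
    (pdt v x + (sab / (1 - v₀ ^ 2 * cs ^ 2)) *
        ((1 - v₀ ^ 2) ^ 2 * cs ^ 2 / (ρ₀ + p₀) * pdr ρ x + v₀ * (1 - cs ^ 2) * pdr v x) = H₂) →
    pdt ρ x = ((ρ₀ + p₀) / (2 * cs)) * (pdt ψm x - sp) ∧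
      pdt v x = ((1 - v₀ ^ 2) / 2) * (pdt ψm x + sp) := by
  intro x ρ₀ v₀ p₀ cs sab H₁ H₂ lm lp ψm ψp sm sp h₁ h₂
  have hψ : pdt ψm x = pdt v x / (1 - v₀ ^ 2) + cs / (ρ₀ + p₀) * pdt ρ x :=
    pdt_half_log_add_comp (hF _ hρ0) hρ hv (by linarith) hv1
  have hsum : ρ₀ + p₀ ≠ 0 :=
    add_ne_zero_of_hasDerivAt_sqrt_deriv_div hp (fun ω hω => (hp' ω hω).1) hF hρ0
  have hcs : cs = v₀ := hsonic.symm
  have hv₀ : v₀ ≠ 0 := hv0.ne'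
  have hv₁ : 1 - v₀ ^ 2 ≠ 0 := by
    have : v₀ ^ 2 < 1 := pow_lt_one₀ hv0.le hv1 two_ne_zero
    linarith
  have hsp : sp = pdt v x / (1 - v₀ ^ 2) - cs * pdt ρ x / (ρ₀ + p₀) := by
    change H₂ / (1 - v₀ ^ 2) - cs * H₁ / (ρ₀ + p₀) = _
    rw [← h₁, ← h₂, hcs]
    generalize sab / (1 - v₀ ^ 2 * v₀ ^ 2) = k
    field_simp
    ring
  rw [hψ, hsp, hcs]
  constructor <;> field_simp <;> ring
end

section
/- Let ρ, p, v, c, A, B, r, κ be real numbers with r > 0, A > 0, B > 0, 0 < c < 1, |v| < 1 and ρ + p > 0, and define λ± = √(AB)(v ± c)/(1 ± vc), H₁ = −(√(AB)/(r(1 − v²c²)))·2v(ρ + p)(1 − κ r²(ρ + p)/(4A)). Let ρ′_L, ρ′_R, v′_L, v′_R be arbitrary real numbers (the one-sided spatial slopes) and define D₋ρ = −(√(AB)/(1 − v²c²))·(c(1 − v²)ρ′_L + (ρ + p)v′_L) + H₁ and D₊ρ = −(√(AB)/(1 − v²c²))·(−c(1 − v²)ρ′_R + (ρ + p)v′_R)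 + H₁. Then (λ₊·D₋ρ − λ₋·D₊ρ)/(λ₊ − λ₋) = −½·(λ₊ρ′_L + λ₋ρ′_R + ((ρ + p)/(c(1 − v²)))·(λ₊v′_L − λ₋v′_R)) + H₁. -/
/-- Eliminating the time derivative from the derivatives along two characteristics of speeds
`lm` and `lp` whose gap is `2 * k * d`. -/
theorem characteristic_combination {lm lp k d w h a b x y : ℝ} (hk : k ≠ 0) (hd : d ≠ 0)
    (hgap : lp - lm = 2 * k * d) :
    (lp * (-k * (d * a + w * x) + h) - lm * (-k * (-d * b + w * y) + h)) / (lp - lm) =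
      -(1 / 2) * (lp * a + lm * b + w / d * (lp * x - lm * y)) + h := by
  obtain rfl : lp = lm + 2 * k * d := by linarith
  rw [add_sub_cancel_left]
  field_simp
  ring

/-- Algebraic identity underlying the acoustic case of the generalized Riemann problem:
the combination `(λ₊ D₋ρ − λ₋ D₊ρ)/(λ₊ − λ₋)` of the one-sided characteristic
directional derivatives of `ρ` equals
`−½(λ₊ρ′_L + λ₋ρ′_R + ((ρ+p)/(c(1−v²)))(λ₊v′_L − λ₋v′_R)) + H₁`. -/
theorem stmt13 (ρ p v c A B r κ : ℝ) (hr : 0 < r) (hA : 0 < A) (hB : 0 < B)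
    (hc0 : 0 < c) (hc1 : c < 1) (hv : |v| < 1) (hρp : 0 < ρ + p)
    (ρL' ρR' vL' vR' : ℝ) :
    let sab : ℝ := Real.sqrt (A * B)
    let lm : ℝ := sab * (v - c) / (1 - v * c)
    let lp : ℝ := sab * (v + c) / (1 + v * c)
    let H₁ : ℝ := -(sab / (r * (1 - v ^ 2 * c ^ 2))) *
      (2 * v * (ρ + p) * (1 - κ * r ^ 2 * (ρ + p) / (4 * A)))
    let Dmρ : ℝ := -(sab / (1 - v ^ 2 * c ^ 2)) *
      (c * (1 - v ^ 2) * ρL' + (ρ + p) * vL') + H₁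
    let Dpρ : ℝ := -(sab / (1 - v ^ 2 * c ^ 2)) *
      (-(c * (1 - v ^ 2)) * ρR' + (ρ + p) * vR') + H₁
    (lp * Dmρ - lm * Dpρ) / (lp - lm) =
      -(1 / 2) * (lp * ρL' + lm * ρR' +
        ((ρ + p) / (c * (1 - v ^ 2))) * (lp * vL' - lm * vR')) + H₁ := by
  obtain ⟨hv₁, hv₂⟩ := abs_lt.mp hv
  intro sab lm lp H₁ Dmρ Dpρ
  have hsab : 0 < sab := Real.sqrt_pos.mpr (mul_pos hA hB)
  have hm : 0 < 1 - v * c := by nlinarith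
  have hp : 0 < 1 + v * c := by nlinarith
  have hvv : 0 < 1 - v ^ 2 := by nlinarith
  have hvc : 0 < 1 - v ^ 2 * c ^ 2 := by nlinarith [mul_pos hm hp]
  have hd : 0 < c * (1 - v ^ 2) := mul_pos hc0 hvv
  have hgap : lp - lm = 2 * (sab / (1 - v ^ 2 * c ^ 2)) * (c * (1 - v ^ 2)) := by
    have hfac : 1 - v ^ 2 * c ^ 2 = (1 + v * c) * (1 - v * c) := by ring
    simp only [lp, lm]
    rw [hfac]
    field_simp
    ring
  exact characteristic_combination (div_pos hsab hvc).ne' hd.ne' hgap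
end

section
/- Let ρ, p, v, c, A, B, r, κ be real numbers with r > 0, A > 0, B > 0, 0 < c < 1, |v| < 1 and ρ + p > 0, and define λ± = √(AB)(v ± c)/(1 ± vc), H₂ = −(√(AB)/(r(1 − v²c²)))·(1 − v²)(−2v²c² + (1 − A)(1 − v²c²)/(2A) + κ r²(p + ρ v²c²)/(2A)). Let ρ′_L, ρ′_R, v′_L, v′_R be arbitrary real numbers and define D₋v = −(√(AB)/(1 − v²c²))·(((1 − v²)²c²/(ρ + p))ρ′_L + c(1 − v²)v′_L) + H₂ and D₊v = −(√(AB)/(1 − v²c²))·(((1 − v²)²c²/(ρ + p))ρ′_R − c(1 − v²)v′_R) + H₂. Then (λ₊·D₋v − λ₋·D₊v)/(λ₊ − λ₋) = −½·(λ₊v′_L + λ₋v′_R + (c(1 − v²)/(ρ + p))·(λ₊ρ′_L − λ₋ρ′_R)) + H₂. -/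
/-- The difference of the characteristic speeds `s (v ± c) / (1 ± v c)`. -/
theorem characteristic_speed_sub (s v c : ℝ) (hm : 1 - v * c ≠ 0) (hp : 1 + v * c ≠ 0) :
    s * (v + c) / (1 + v * c) - s * (v - c) / (1 - v * c) =
      2 * c * (1 - v ^ 2) * (s / (1 - v ^ 2 * c ^ 2)) := by
  rw [show 1 - v ^ 2 * c ^ 2 = (1 - v * c) * (1 + v * c) by ring]
  field_simp
  ring

/-- Algebraic identity underlying the acoustic case of the generalized Riemann problem:
the combination `(λ₊ D₋v − λ₋ D₊v)/(λ₊ − λ₋)` of the one-sided characteristic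
directional derivatives of `v` equals
`−½(λ₊v′_L + λ₋v′_R + (c(1−v²)/(ρ+p))(λ₊ρ′_L − λ₋ρ′_R)) + H₂`. -/
theorem stmt14 (ρ p v c A B r κ : ℝ) (hr : 0 < r) (hA : 0 < A) (hB : 0 < B)
    (hc0 : 0 < c) (hc1 : c < 1) (hv : |v| < 1) (hρp : 0 < ρ + p)
    (ρL' ρR' vL' vR' : ℝ) :
    let sab : ℝ := Real.sqrt (A * B)
    let lm : ℝ := sab * (v - c) / (1 - v * c)
    let lp : ℝ := sab * (v + c) / (1 + v * c)
    let H₂ : ℝ := -(sab / (r * (1 - v ^ 2 * c ^ 2))) *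
      ((1 - v ^ 2) * (-(2 * v ^ 2 * c ^ 2) +
        (1 - A) * (1 - v ^ 2 * c ^ 2) / (2 * A) +
        κ * r ^ 2 * (p + ρ * v ^ 2 * c ^ 2) / (2 * A)))
    let Dmv : ℝ := -(sab / (1 - v ^ 2 * c ^ 2)) *
      (((1 - v ^ 2) ^ 2 * c ^ 2 / (ρ + p)) * ρL' + c * (1 - v ^ 2) * vL') + H₂
    let Dpv : ℝ := -(sab / (1 - v ^ 2 * c ^ 2)) *
      (((1 - v ^ 2) ^ 2 * c ^ 2 / (ρ + p)) * ρR' - c * (1 - v ^ 2) * vR') + H₂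
    (lp * Dmv - lm * Dpv) / (lp - lm) =
      -(1 / 2) * (lp * vL' + lm * vR' +
        ((c * (1 - v ^ 2)) / (ρ + p)) * (lp * ρL' - lm * ρR')) + H₂ := by
  intro sab lm lp H₂ Dmv Dpv
  have hvc : |v * c| < 1 := by
    rw [abs_mul, abs_of_pos hc0]
    exact mul_lt_one_of_nonneg_of_lt_one_left (abs_nonneg v) hv hc1.le
  obtain ⟨hvc₁, hvc₂⟩ := abs_lt.mp hvc
  have hsub : lp - lm = 2 * c * (1 - v ^ 2) * (sab / (1 - v ^ 2 * c ^ 2)) :=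
    characteristic_speed_sub sab v c (by linarith) (by linarith)
  have hsab : 0 < sab := Real.sqrt_pos.mpr (mul_pos hA hB)
  have hv2 : 0 < 1 - v ^ 2 := sub_pos.mpr ((sq_lt_one_iff_abs_lt_one v).mpr hv)
  have hvc2 : 0 < 1 - v ^ 2 * c ^ 2 := by
    rw [← mul_pow]
    exact sub_pos.mpr ((sq_lt_one_iff_abs_lt_one _).mpr hvc)
  have hne : lp - lm ≠ 0 := by
    rw [hsub]
    positivity
  rw [div_eq_iff hne]
  simp only [Dmv, Dpv]
  clear_value H₂ lp lm
  linear_combination (1 / 2) * (lp * vL' + lm * vR' +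
    ((c * (1 - v ^ 2)) / (ρ + p)) * (lp * ρL' - lm * ρR')) * hsub
end

section
/- Let σ ∈ (0, 1), G > 0, κ = 8πG, B₀ > 0, and γ = σ²/(2πG(1 + 6σ² + σ⁴)). Define on (0, ∞) the static Tolmann–Oppenheimer–Volkoff data: ρ(r) = γ/r², v(r) = 0, p(r) = σ²ρ(r), M(r) = 4πGγ r, A(r) = 1 − 8πGγ, B(r) = B₀ r^(4σ²/(1+σ²)), and the stress-energy components 𝒯⁰⁰(r) = ρ(r), 𝒯⁰¹(r) = 0, 𝒯¹¹(r) = p(r). Then for every r > 0: (i) A(r) = 1 − 2M(r)/r and M′(r) = ½κr²𝒯⁰⁰(r); (ii) B′(r)/B(r) = (1 − A(r))/(A(r)r) + (κr/A(r))·𝒯¹¹(r); (iii) the momentum equation is satisfied in steady form: d/dr(√(A(r)B(r))·𝒯¹¹(r)) = −√(A(r)B(r))·(2𝒯¹¹(r)/r + (1 − A(r))(𝒯⁰⁰(r) − 𝒯¹¹(r))/(2A(r)r) + κr(𝒯⁰⁰(r)𝒯¹¹(r) − 𝒯⁰¹(r)²)/A(r) − 2p(r)/r). In particular these time-independent functions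 form an exact stationary solution of the coupled spherically symmetric Einstein–relativistic-hydrodynamics system. -/
/-- The static Tolmann–Oppenheimer–Volkoff data `ρ(r) = γ/r²`, `v = 0`, `p = σ²ρ`,
`M(r) = 4πGγr`, `A = 1 − 8πGγ`, `B(r) = B₀ r^{4σ²/(1+σ²)}` with
`γ = σ²/(2πG(1 + 6σ² + σ⁴))` form an exact stationary solution of the coupled
spherically symmetric Einstein–relativistic-hydrodynamics system: the two metric
constraint equations and the steady momentum equation hold for every `r > 0`. -/
theorem stmt15 (σ G B₀ κ γ : ℝ) (hσ : σ ∈ Set.Ioo (0 : ℝ) 1) (hG : 0 < G)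
    (hB₀ : 0 < B₀) (hκ : κ = 8 * Real.pi * G)
    (hγ : γ = σ ^ 2 / (2 * Real.pi * G * (1 + 6 * σ ^ 2 + σ ^ 4))) :
    let ρ : ℝ → ℝ := fun r => γ / r ^ 2
    let pfun : ℝ → ℝ := fun r => σ ^ 2 * ρ r
    let M : ℝ → ℝ := fun r => 4 * Real.pi * G * γ * r
    let A : ℝ → ℝ := fun _ => 1 - 8 * Real.pi * G * γ
    let B : ℝ → ℝ := fun r => B₀ * r ^ (4 * σ ^ 2 / (1 + σ ^ 2))
    let T00 : ℝ → ℝ := ρ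
    let T01 : ℝ → ℝ := fun _ => 0
    let T11 : ℝ → ℝ := pfun
    ∀ r : ℝ, 0 < r →
      (A r = 1 - 2 * M r / r ∧ HasDerivAt M ((1 / 2) * κ * r ^ 2 * T00 r) r) ∧
      deriv B r / B r = (1 - A r) / (A r * r) + (κ * r / A r) * T11 r ∧
      HasDerivAt (fun x => Real.sqrt (A x * B x) * T11 x)
        (-(Real.sqrt (A r * B r)) *
          (2 * T11 r / r + (1 - A r) * (T00 r - T11 r) / (2 * A r * r) +
            κ * r * (T00 r * T11 r - (T01 r) ^ 2) / A r - 2 * pfun r / r)) r := by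
  intro ρ pfun M A B T00 T01 T11 r hr
  have hD : 0 < 1 + 6 * σ ^ 2 + σ ^ 4 := by positivity
  have hs : 0 < 1 + σ ^ 2 := by positivity
  have hc : 8 * Real.pi * G * γ = 4 * σ ^ 2 / (1 + 6 * σ ^ 2 + σ ^ 4) := by
    have hπ := Real.pi_pos
    rw [hγ]
    field_simp
    ring
  have hκγ : κ * γ = 4 * σ ^ 2 / (1 + 6 * σ ^ 2 + σ ^ 4) := by rw [hκ, hc]
  have hA : 1 - 8 * Real.pi * G * γ = (1 + σ ^ 2) ^ 2 / (1 + 6 * σ ^ 2 + σ ^ 4) := by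
    rw [hc]
    field_simp
    ring
  have hApos : 0 < A r := by
    change 0 < 1 - 8 * Real.pi * G * γ
    rw [hA]
    positivity
  have hBpos : 0 < B r := mul_pos hB₀ (Real.rpow_pos_of_pos hr _)
  have hB : HasDerivAt B (4 * σ ^ 2 / (1 + σ ^ 2) / r * B r) r := by
    refine ((Real.hasDerivAt_rpow_const (p := 4 * σ ^ 2 / (1 + σ ^ 2))
      (Or.inl hr.ne')).const_mul B₀).congr_deriv ?_
    rw [Real.rpow_sub_one hr.ne']
    simp only [B]
    ring
  have hsqrt : HasDerivAt (fun x => Real.sqrt (A x * B x))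
      (2 * σ ^ 2 / (1 + σ ^ 2) / r * Real.sqrt (A r * B r)) r := by
    have hAB : 0 < A r * B r := mul_pos hApos hBpos
    refine ((hB.const_mul (A r)).sqrt hAB.ne').congr_deriv ?_
    have hq := Real.sqrt_pos.2 hAB
    have hsq := Real.sq_sqrt hAB.le
    rw [div_eq_iff (by positivity)]
    linear_combination (-(4 * σ ^ 2 / (1 + σ ^ 2) / r)) * hsq
  have hp : HasDerivAt T11 (-2 * σ ^ 2 * γ / r ^ 3) r := by
    refine (((hasDerivAt_const r γ).div (hasDerivAt_pow 2 r)
      (pow_ne_zero 2 hr.ne')).const_mul (σ ^ 2)).congr_deriv ?_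
    field_simp
    ring
  refine ⟨⟨?_, ?_⟩, ?_, ?_⟩
  · simp only [A, M]
    field_simp
    ring
  · refine ((hasDerivAt_id r).const_mul (4 * Real.pi * G * γ)).congr_deriv ?_
    simp only [T00, ρ, hκ]
    field_simp
    ring
  · rw [hB.deriv, mul_div_cancel_right₀ _ hBpos.ne']
    have hT : κ * r / A r * T11 r = κ * γ * σ ^ 2 / (A r * r) := by
      simp only [T11, pfun, ρ]
      field_simp
    rw [hT, hκγ]
    simp only [A, hA]
    field_simp
    ring
  · refine (hsqrt.mul hp).congr_deriv ?_
    have hT : κ * r * (T00 r * T11 r - T01 r ^ 2) / A r =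
        κ * γ * (σ ^ 2 * γ) / (A r * r ^ 3) := by
      simp only [T00, T01, T11, pfun, ρ]
      field_simp
      ring
    rw [hT, hκγ]
    generalize Real.sqrt (A r * B r) = q
    simp only [A, T00, T11, pfun, ρ, hA]
    field_simp
    ring
end

section
/- Let κ be a real constant and Ω ⊂ {(t, r) ∈ ℝ² : r > 0} an open set. Let M : Ω → ℝ be twice continuously differentiable, and let 𝒯⁰⁰ and G := √(AB)·𝒯⁰¹ be continuously differentiable functions on Ω. Suppose that on Ω: (i) ∂M/∂r = ½κr²𝒯⁰⁰, and (ii) the continuity equation ∂𝒯⁰⁰/∂t + ∂G/∂r = −(2/r)·G holds. Then ∂/∂r(∂M/∂t + ½κr²G) = 0 on Ω; i.e., the quantity ∂M/∂t + ½κr²√(AB)𝒯⁰¹ does not depend on r, which justifies replacing the spatial constraint ∂M/∂r = ½κr²𝒯⁰⁰ by the evolution equation ∂M/∂t = −½κr²√(AB)𝒯⁰¹. -/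
/-- Mixed partial derivatives of a `C²` function commute. -/
theorem pdr_pdt_comm {f : ℝ × ℝ → ℝ} {x : ℝ × ℝ} (hf : ContDiffAt ℝ 2 f x) :
    pdr (pdt f) x = pdt (pdr f) x := by
  have hd : DifferentiableAt ℝ (fderiv ℝ f) x :=
    (hf.fderiv_right (m := 1) (by norm_num)).differentiableAt (by norm_num)
  have key : ∀ v w : ℝ × ℝ,
      fderiv ℝ (fun y => fderiv ℝ f y v) x w = fderiv ℝ (fderiv ℝ f) x w v := by
    intro v w
    rw [(hd.hasFDerivAt.clm_apply (hasFDerivAt_const v x)).fderiv]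
    simp
  have hsymm : IsSymmSndFDerivAt ℝ f x := hf.isSymmSndFDerivAt (by simp)
  exact (key (1, 0) (0, 1)).trans ((hsymm (0, 1) (1, 0)).trans (key (0, 1) (1, 0)).symm)

theorem fderiv_const_mul_sq_snd_mul {F : ℝ × ℝ → ℝ} {x : ℝ × ℝ} (c : ℝ)
    (hF : DifferentiableAt ℝ F x) (v : ℝ × ℝ) :
    fderiv ℝ (fun y => c * y.2 ^ 2 * F y) x v =
      c * x.2 ^ 2 * fderiv ℝ F x v + 2 * c * x.2 * v.2 * F x := by
  have h : HasFDerivAt (fun y : ℝ × ℝ => y.2 ^ 2) _ x := (hasFDerivAt_snd (𝕜 := ℝ)).pow 2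
  rw [((h.const_mul c).fun_mul hF.hasFDerivAt).fderiv]
  simp
  ring

/-- If on an open set `Ω ⊆ {r > 0}` the mass function satisfies the spatial constraint
`∂M/∂r = ½κr²𝒯⁰⁰` and the continuity equation `∂𝒯⁰⁰/∂t + ∂G/∂r = −(2/r)G` holds
(with `G = √(AB)𝒯⁰¹`), then `∂/∂r(∂M/∂t + ½κr²G) = 0` on `Ω`; i.e. the quantity
`∂M/∂t + ½κr²√(AB)𝒯⁰¹` is independent of `r`, which justifies replacing the spatial
constraint by the evolution equation `∂M/∂t = −½κr²√(AB)𝒯⁰¹`. -/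
theorem stmt16 (κ : ℝ) (Ω : Set (ℝ × ℝ)) (hΩopen : IsOpen Ω)
    (hΩ : Ω ⊆ {x : ℝ × ℝ | 0 < x.2})
    (M T00 G : ℝ × ℝ → ℝ)
    (hM : ContDiffOn ℝ 2 M Ω) (hT : ContDiffOn ℝ 1 T00 Ω) (hG : ContDiffOn ℝ 1 G Ω)
    (h1 : ∀ x ∈ Ω, pdr M x = (1 / 2) * κ * x.2 ^ 2 * T00 x)
    (h2 : ∀ x ∈ Ω, pdt T00 x + pdr G x = -(2 / x.2) * G x) :
    ∀ x ∈ Ω, pdr (fun y => pdt M y + (1 / 2) * κ * y.2 ^ 2 * G y) x = 0 := by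
  intro x hx
  have hnhds : Ω ∈ nhds x := hΩopen.mem_nhds hx
  have hMx : ContDiffAt ℝ 2 M x := hM.contDiffAt hnhds
  have hTx : DifferentiableAt ℝ T00 x := (hT.contDiffAt hnhds).differentiableAt (by norm_num)
  have hGx : DifferentiableAt ℝ G x := (hG.contDiffAt hnhds).differentiableAt (by norm_num)
  have hpdt : DifferentiableAt ℝ (pdt M) x :=
    ((hMx.fderiv_right (m := 1) (by norm_num)).differentiableAt (by norm_num)).clm_apply
      (differentiableAt_const _)
  have hsplit : pdr (fun y => pdt M y + (1 / 2) * κ * y.2 ^ 2 * G y) x =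
      pdr (pdt M) x + pdr (fun y => (1 / 2) * κ * y.2 ^ 2 * G y) x := by
    have hd : DifferentiableAt ℝ (fun y : ℝ × ℝ => (1 / 2) * κ * y.2 ^ 2 * G y) x := by
      fun_prop
    simp only [pdr]
    rw [fderiv_fun_add hpdt hd]
    rfl
  have hr : pdr (fun y => (1 / 2) * κ * y.2 ^ 2 * G y) x =
      (1 / 2) * κ * x.2 ^ 2 * pdr G x + 2 * ((1 / 2) * κ) * x.2 * 1 * G x :=
    fderiv_const_mul_sq_snd_mul _ hGx (0, 1)
  have ht : pdt (fun y => (1 / 2) * κ * y.2 ^ 2 * T00 y) x =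
      (1 / 2) * κ * x.2 ^ 2 * pdt T00 x + 2 * ((1 / 2) * κ) * x.2 * 0 * T00 x :=
    fderiv_const_mul_sq_snd_mul _ hTx (1, 0)
  have hcongr : pdt (pdr M) x = pdt (fun y => (1 / 2) * κ * y.2 ^ 2 * T00 y) x := by
    have h : pdr M =ᶠ[nhds x] fun y => (1 / 2) * κ * y.2 ^ 2 * T00 y :=
      Filter.eventually_of_mem hnhds h1
    simp only [pdt]
    rw [h.fderiv_eq]
  have hx2 : x.2 ≠ 0 := (hΩ hx).ne'
  have hcont : pdt T00 x = -(2 / x.2) * G x - pdr G x := eq_sub_of_add_eq (h2 x hx)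
  rw [hsplit, pdr_pdt_comm hMx, hcongr, ht, hr, hcont]
  field_simp
  ring
end
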